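/- There is an absolute constant c > 0 such that for every integer k > 2 there exists a k-permutation π with liminf_{n→∞} ex(n,π)/n ≥ 2^{c·k^{1/4}}. -/

import Mathlib

open Filter

/-- A binary matrix `A` contains a binary matrix `P` (as a submatrix pattern):
there are strictly increasing choices of rows and columns such that `A` has a
one wherever `P` does. -/
def ContainsMat {k l m n : ℕ} (P : Fin k → Fin l → Bool) (A : Fin m → Fin n → Bool) : Prop :=
  ∃ (r : Fin k → Fin m) (c : Fin l → Fin n), StrictMono r ∧ StrictMono c ∧
    ∀ i j, P i j = true → A (r i) (c j) = true

/-- The permutation matrix of a permutation of `{1,…,k}`. -/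
def permMatrix {k : ℕ} (π : Equiv.Perm (Fin k)) : Fin k → Fin k → Bool :=
  fun i j => decide (π i = j)

/-- The mass of a binary matrix: the number of its one-entries. -/
def mass {m n : ℕ} (A : Fin m → Fin n → Bool) : ℕ :=
  (Finset.univ.filter fun p : Fin m × Fin n => A p.1 p.2 = true).card

/-- A binary matrix avoids a permutation if it avoids its permutation matrix. -/
def AvoidsPerm {k m n : ℕ} (A : Fin m → Fin n → Bool) (π : Equiv.Perm (Fin k)) : Prop :=
  ¬ ContainsMat (permMatrix π) A

/-- `ex n π`: the maximum mass of an `n × n` binary matrix avoiding `π`. -/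
noncomputable def exP {k : ℕ} (n : ℕ) (π : Equiv.Perm (Fin k)) : ℕ :=
  sSup {m | ∃ A : Fin n → Fin n → Bool, AvoidsPerm A π ∧ mass A = m}

/-- `ex n U` for a set `U` of permutations: the maximum mass of an `n × n`
binary matrix avoiding every permutation in `U`. -/
noncomputable def exU {k : ℕ} (n : ℕ) (U : Finset (Equiv.Perm (Fin k))) : ℕ :=
  sSup {m | ∃ A : Fin n → Fin n → Bool, (∀ π ∈ U, AvoidsPerm A π) ∧ mass A = m}

/-- An `n`-permutation `σ` contains a `k`-permutation `π`. -/
def PermContains {n k : ℕ} (σ : Equiv.Perm (Fin n)) (π : Equiv.Perm (Fin k)) : Prop :=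
  ∃ x : Fin k → Fin n, StrictMono x ∧ ∀ i j, σ (x i) < σ (x j) ↔ π i < π j

/-- `S n π`: the number of `n`-permutations avoiding `π`. -/
noncomputable def SP {k : ℕ} (n : ℕ) (π : Equiv.Perm (Fin k)) : ℕ :=
  Nat.card {σ : Equiv.Perm (Fin n) // ¬ PermContains σ π}

/-- `S n U`: the number of `n`-permutations avoiding every permutation in `U`. -/
noncomputable def SU {k : ℕ} (n : ℕ) (U : Finset (Equiv.Perm (Fin k))) : ℕ :=
  Nat.card {σ : Equiv.Perm (Fin n) // ∀ π ∈ U, ¬ PermContains σ π}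

/-- `T n π`: the number of `n × n` binary matrices avoiding `π`. -/
noncomputable def TP {k : ℕ} (n : ℕ) (π : Equiv.Perm (Fin k)) : ℕ :=
  Nat.card {A : Fin n → Fin n → Bool // AvoidsPerm A π}

/-- `P` is an interval minor of `A`: there are ordered disjoint row intervals
`[rlo a, rhi a]` and column intervals `[clo b, chi b]` such that wherever `P`
has a one, the corresponding block of `A` contains a one. -/
def IntervalMinor {k l m n : ℕ} (P : Fin k → Fin l → Bool) (A : Fin m → Fin n → Bool) : Prop :=
  ∃ (rlo rhi : Fin k → Fin m) (clo chi : Fin l → Fin n),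
    (∀ a, rlo a ≤ rhi a) ∧ (∀ a b, a < b → rhi a < rlo b) ∧
    (∀ a, clo a ≤ chi a) ∧ (∀ a b, a < b → chi a < clo b) ∧
    ∀ a b, P a b = true → ∃ i j, rlo a ≤ i ∧ i ≤ rhi a ∧ clo b ≤ j ∧ j ≤ chi b ∧ A i j = true

/-- The all-ones `k × l` binary matrix. -/
def J (k l : ℕ) : Fin k → Fin l → Bool := fun _ _ => true

/-- `m n P`: the maximum mass of an `n × n` binary matrix avoiding `P` as an
interval minor. -/
noncomputable def mP {k l : ℕ} (n : ℕ) (P : Fin k → Fin l → Bool) : ℕ :=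
  sSup {m | ∃ A : Fin n → Fin n → Bool, ¬ IntervalMinor P A ∧ mass A = m}

/-- `f_P(t,s)`: the supremum (in `ℕ∞`) of those `N` for which there is an
`N × t` binary matrix with at least `s` ones in each row avoiding `P` as an
interval minor. -/
noncomputable def fP {k l : ℕ} (P : Fin k → Fin l → Bool) (t s : ℕ) : ℕ∞ :=
  sSup {x : ℕ∞ | ∃ N : ℕ, x = (N : ℕ∞) ∧ ∃ A : Fin N → Fin t → Bool,
    (∀ i, s ≤ (Finset.univ.filter fun j => A i j = true).card) ∧ ¬ IntervalMinor P A}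

/-- `g_P(t,s)`: the supremum (in `ℕ∞`) of those `N` for which there is a
`t × N` binary matrix with at least `s` ones in each column avoiding `P` as an
interval minor. -/
noncomputable def gP {k l : ℕ} (P : Fin k → Fin l → Bool) (t s : ℕ) : ℕ∞ :=
  sSup {x : ℕ∞ | ∃ N : ℕ, x = (N : ℕ∞) ∧ ∃ A : Fin t → Fin N → Bool,
    (∀ j, s ≤ (Finset.univ.filter fun i => A i j = true).card) ∧ ¬ IntervalMinor P A}

namespace StanleyWilf

/-- `S` contains the pattern of `π`. -/
def Cont {k : ℕ} (π : Equiv.Perm (Fin k)) (S : Finset (ℕ × ℕ)) : Prop :=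
  ∃ r c : Fin k → ℕ, StrictMono r ∧ StrictMono c ∧ ∀ i, (r i, c (π i)) ∈ S

lemma exP_bdd {k : ℕ} (n : ℕ) (π : Equiv.Perm (Fin k)) :
    BddAbove {m | ∃ A : Fin n → Fin n → Bool, AvoidsPerm A π ∧ mass A = m} := by
  refine ⟨n * n, ?_⟩
  rintro m ⟨A, -, rfl⟩
  unfold mass
  refine (Finset.card_le_univ _).trans ?_
  simp

lemma le_exP {k : ℕ} (n : ℕ) (π : Equiv.Perm (Fin k)) (S : Finset (ℕ × ℕ))
    (hS : ∀ p ∈ S, p.1 < n ∧ p.2 < n) (hc : ¬ Cont π S) : S.card ≤ exP n π := by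
  classical
  have hm : S.card = mass (fun u v : Fin n => decide (((u : ℕ), (v : ℕ)) ∈ S)) := by
    unfold mass
    symm
    refine Finset.card_bij (fun p _ => ((p.1 : ℕ), (p.2 : ℕ))) ?_ ?_ ?_
    · intro p hp
      simpa using hp
    · intro p _ q _ h
      simp only [Prod.mk.injEq] at h
      exact Prod.ext (Fin.ext h.1) (Fin.ext h.2)
    · intro p hp
      exact ⟨(⟨p.1, (hS p hp).1⟩, ⟨p.2, (hS p hp).2⟩), by simpa using hp, rfl⟩
  rw [hm]
  refine le_csSup (exP_bdd n π) ⟨_, ?_, rfl⟩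
  rintro ⟨r, c, hr, hcc, h⟩
  refine hc ⟨fun i => r i, fun i => c i, fun a b hab => hr hab, fun a b hab => hcc hab, fun i => ?_⟩
  have := h i (π i) (by simp [permMatrix])
  simpa using this

lemma exP_le {k : ℕ} (n : ℕ) (π : Equiv.Perm (Fin k)) (X : ℕ)
    (h : ∀ S : Finset (ℕ × ℕ), (∀ p ∈ S, p.1 < n ∧ p.2 < n) → ¬ Cont π S → S.card ≤ X) :
    exP n π ≤ X := by
  classical
  refine csSup_le' ?_
  rintro m ⟨A, hA, rfl⟩
  set T := (Finset.univ.filter fun p : Fin n × Fin n => A p.1 p.2 = true) with hT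
  have hinj : Function.Injective (fun p : Fin n × Fin n => ((p.1 : ℕ), (p.2 : ℕ))) := by
    intro p q h
    simp only [Prod.mk.injEq] at h
    exact Prod.ext (Fin.ext h.1) (Fin.ext h.2)
  have hcard : mass A = (T.image (fun p : Fin n × Fin n => ((p.1 : ℕ), (p.2 : ℕ)))).card := by
    rw [Finset.card_image_of_injective _ hinj]; rfl
  rw [hcard]
  apply h
  · intro p hp
    obtain ⟨q, -, rfl⟩ := Finset.mem_image.1 hp
    exact ⟨q.1.2, q.2.2⟩
  · rintro ⟨r, c, hr, hcc, hh⟩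
    apply hA
    have key : ∀ i, ∃ q : Fin n × Fin n, A q.1 q.2 = true ∧ (q.1 : ℕ) = r i ∧ (q.2 : ℕ) = c (π i) := by
      intro i
      obtain ⟨q, hq, e⟩ := Finset.mem_image.1 (hh i)
      simp only [Prod.mk.injEq] at e
      exact ⟨q, by simpa [hT] using hq, e⟩
    choose q hq1 hq2 hq3 using key
    refine ⟨fun i => (q i).1, fun j => (q (π.symm j)).2, ?_, ?_, ?_⟩
    · intro a b hab
      rw [Fin.lt_def, hq2, hq2]; exact hr hab
    · intro a b hab
      rw [Fin.lt_def, hq3, hq3]; simpa using hcc hab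
    · intro i j hij
      have : π i = j := by simpa [permMatrix] using hij
      subst this
      simpa using hq1 i

lemma trivial_bound {k : ℕ} (hk : 2 < k) (π : Equiv.Perm (Fin k)) (n : ℕ) (hn : 2 ≤ n) :
    2 * n ≤ exP n π := by
  have := le_exP n π (Finset.range 2 ×ˢ Finset.range n) (by
    intro p hp
    simp only [Finset.mem_product, Finset.mem_range] at hp
    omega) (by
    rintro ⟨r, c, hr, -, h⟩
    have h0 := hr (show (⟨0, by omega⟩ : Fin k) < ⟨1, by omega⟩ by simp)
    have h1 := hr (show (⟨1, by omega⟩ : Fin k) < ⟨2, by omega⟩ by simp)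
    have h2 := h ⟨2, by omega⟩
    simp only [Finset.mem_product, Finset.mem_range] at h2
    omega)
  simpa using this

/-- wide blocks -/
lemma wide_bound {k : ℕ} (K n : ℕ) (hK : 0 < K) (π : Equiv.Perm (Fin k))
    (S : Finset (ℕ × ℕ)) (hS : ∀ p ∈ S, p.1 < K * n ∧ p.2 < K * n) (hc : ¬ Cont π S)
    (W : Finset (ℕ × ℕ)) (hWn : ∀ b ∈ W, b.2 < n)
    (hW : ∀ b ∈ W, k ≤ (((S.filter fun p => p.1 / K = b.1 ∧ p.2 / K = b.2)).image
      (fun p => p.2 % K)).card) :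
    W.card ≤ (n * 2 ^ K) * k := by
  classical
  by_contra hlt
  push Not at hlt
  let F : ℕ × ℕ → ℕ × Finset ℕ := fun b =>
    (b.2, ((S.filter fun p => p.1 / K = b.1 ∧ p.2 / K = b.2)).image (fun p => p.2 % K))
  have hmaps : ∀ b ∈ W, F b ∈ (Finset.range n ×ˢ (Finset.range K).powerset) := by
    intro b hb
    simp only [F, Finset.mem_product, Finset.mem_range, Finset.mem_powerset]
    refine ⟨hWn b hb, ?_⟩
    intro x hx
    obtain ⟨p, -, rfl⟩ := Finset.mem_image.1 hx
    exact Finset.mem_range.2 (Nat.mod_lt _ hK)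
  obtain ⟨⟨j, V⟩, -, hfib⟩ := Finset.exists_lt_card_fiber_of_mul_lt_card_of_maps_to hmaps
    (n := k) (by simpa using hlt)
  set G := W.filter (fun b => F b = (j, V)) with hG
  have hGmem : ∀ b ∈ G, b ∈ W ∧ b.2 = j ∧
      ((S.filter fun p => p.1 / K = b.1 ∧ p.2 / K = b.2)).image (fun p => p.2 % K) = V := by
    intro b hb
    have := (Finset.mem_filter.1 hb)
    simp only [F, Prod.mk.injEq] at this
    exact this
  have hI : (G.image Prod.fst).card = G.card := by
    apply Finset.card_image_of_injOn
    intro b hb b' hb' h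
    exact Prod.ext h (((hGmem b hb).2.1).trans ((hGmem b' hb').2.1).symm)
  have hGne : G.Nonempty := Finset.card_pos.1 (by omega)
  have hV : k ≤ V.card := by
    obtain ⟨b, hb⟩ := hGne
    have := hW b (hGmem b hb).1
    rwa [(hGmem b hb).2.2] at this
  let ρ := Finset.orderEmbOfCardLe (G.image Prod.fst) (k := k) (by omega)
  let w := Finset.orderEmbOfCardLe V hV
  have key : ∀ t : Fin k, ∃ p ∈ S, p.1 / K = ρ t ∧ p.2 = K * j + w (π t) := by
    intro t
    have h1 : ρ t ∈ G.image Prod.fst := Finset.orderEmbOfCardLe_mem _ _ _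
    obtain ⟨b, hb, hbe⟩ := Finset.mem_image.1 h1
    have h2 : w (π t) ∈ V := Finset.orderEmbOfCardLe_mem _ _ _
    rw [← (hGmem b hb).2.2] at h2
    obtain ⟨p, hp, hpe⟩ := Finset.mem_image.1 h2
    obtain ⟨hpS, hp1, hp2⟩ := Finset.mem_filter.1 hp
    refine ⟨p, hpS, hp1.trans hbe, ?_⟩
    rw [← hpe, ← (hGmem b hb).2.1, ← hp2, Nat.div_add_mod]
  choose p hpS hp1 hp2 using key
  refine hc ⟨fun t => (p t).1, fun a => K * j + w a, ?_, ?_, ?_⟩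
  · intro a b hab
    have : (p a).1 / K < (p b).1 / K := by
      rw [hp1, hp1]; exact ρ.strictMono hab
    by_contra hh
    push Not at hh
    exact absurd (Nat.div_le_div_right (c := K) hh) (by omega)
  · intro a b hab
    have := w.strictMono hab
    show K * j + w a < K * j + w b
    omega
  · intro i
    have := hpS i
    show ((p i).1, K * j + w (π i)) ∈ S
    rw [← hp2]; exact this

lemma cont_swap {k : ℕ} (π : Equiv.Perm (Fin k)) (S : Finset (ℕ × ℕ))
    (h : Cont π.symm (S.image Prod.swap)) : Cont π S := by
  obtain ⟨r, c, hr, hc, h⟩ := h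
  refine ⟨c, r, hc, hr, fun i => ?_⟩
  have := h (π i)
  simpa using this

lemma tall_bound {k : ℕ} (K n : ℕ) (hK : 0 < K) (π : Equiv.Perm (Fin k))
    (S : Finset (ℕ × ℕ)) (hS : ∀ p ∈ S, p.1 < K * n ∧ p.2 < K * n) (hc : ¬ Cont π S)
    (W : Finset (ℕ × ℕ)) (hWn : ∀ b ∈ W, b.1 < n)
    (hW : ∀ b ∈ W, k ≤ (((S.filter fun p => p.1 / K = b.1 ∧ p.2 / K = b.2)).image
      (fun p => p.1 % K)).card) :
    W.card ≤ (n * 2 ^ K) * k := by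
  classical
  have := wide_bound K n hK π.symm (S.image Prod.swap) (by
      intro p hp
      obtain ⟨q, hq, rfl⟩ := Finset.mem_image.1 hp
      exact ⟨(hS q hq).2, (hS q hq).1⟩) (fun h => hc (cont_swap π S h)) (W.image Prod.swap) (by
      intro b hb
      obtain ⟨q, hq, rfl⟩ := Finset.mem_image.1 hb
      exact hWn q hq) (by
      intro b hb
      obtain ⟨q, hq, rfl⟩ := Finset.mem_image.1 hb
      refine (hW q hq).trans (Finset.card_le_card ?_)
      intro x hx
      obtain ⟨p, hp, rfl⟩ := Finset.mem_image.1 hx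
      obtain ⟨hpS, hp1, hp2⟩ := Finset.mem_filter.1 hp
      refine Finset.mem_image.2 ⟨p.swap, ?_, rfl⟩
      refine Finset.mem_filter.2 ⟨Finset.mem_image_of_mem _ hpS, hp2, hp1⟩)
  rwa [Finset.card_image_of_injective _ Prod.swap_injective] at this

lemma block_cont {k : ℕ} (K : ℕ) (π : Equiv.Perm (Fin k)) (S : Finset (ℕ × ℕ))
    (h : Cont π (S.image fun p => (p.1 / K, p.2 / K))) : Cont π S := by
  obtain ⟨r, c, hr, hc, h⟩ := h
  have key : ∀ i, ∃ p ∈ S, p.1 / K = r i ∧ p.2 / K = c (π i) := by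
    intro i
    obtain ⟨p, hp, e⟩ := Finset.mem_image.1 (h i)
    simp only [Prod.mk.injEq] at e
    exact ⟨p, hp, e⟩
  choose p hpS hp1 hp2 using key
  have aux : ∀ x y : ℕ, x / K < y / K → x < y := by
    intro x y hxy
    by_contra hh
    push Not at hh
    exact absurd (Nat.div_le_div_right (c := K) hh) (by omega)
  refine ⟨fun i => (p i).1, fun j => (p (π.symm j)).2, ?_, ?_, ?_⟩
  · intro a b hab
    apply aux
    rw [hp1, hp1]; exact hr hab
  · intro a b hab
    apply aux
    rw [hp2, hp2]; simpa using hc hab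
  · intro i
    simpa using hpS i

lemma mt_step {k : ℕ} (hk : 0 < k) (K n F : ℕ) (hK : 0 < K) (π : Equiv.Perm (Fin k))
    (hF : ∀ S : Finset (ℕ × ℕ), (∀ p ∈ S, p.1 < n ∧ p.2 < n) → ¬ Cont π S → S.card ≤ F)
    (S : Finset (ℕ × ℕ)) (hS : ∀ p ∈ S, p.1 < K * n ∧ p.2 < K * n) (hc : ¬ Cont π S) :
    S.card ≤ (k - 1) ^ 2 * F + 2 * (n * 2 ^ K * k) * K ^ 2 := by
  classical
  set S' := S.image fun p => (p.1 / K, p.2 / K) with hS'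
  let fib : ℕ × ℕ → Finset (ℕ × ℕ) := fun b => S.filter fun p => p.1 / K = b.1 ∧ p.2 / K = b.2
  have hS'n : ∀ b ∈ S', b.1 < n ∧ b.2 < n := by
    intro b hb
    obtain ⟨p, hp, rfl⟩ := Finset.mem_image.1 hb
    exact ⟨Nat.div_lt_of_lt_mul (hS p hp).1, Nat.div_lt_of_lt_mul (hS p hp).2⟩
  have hS'card : S'.card ≤ F := hF S' hS'n fun h => hc (block_cont K π S h)
  have hsum : S.card = ∑ b ∈ S', (fib b).card := by
    rw [Finset.card_eq_sum_card_image (fun p : ℕ × ℕ => (p.1 / K, p.2 / K)) S]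
    refine Finset.sum_congr rfl fun b _ => ?_
    congr 1
    ext p
    simp [fib, Prod.ext_iff]
  let W := S'.filter fun b => k ≤ ((fib b).image (fun p => p.2 % K)).card
  let T := S'.filter fun b => k ≤ ((fib b).image (fun p => p.1 % K)).card
  have hW : W.card ≤ n * 2 ^ K * k := wide_bound K n hK π S hS hc W
    (fun b hb => (hS'n b (Finset.mem_filter.1 hb).1).2) (fun b hb => (Finset.mem_filter.1 hb).2)
  have hT : T.card ≤ n * 2 ^ K * k := tall_bound K n hK π S hS hc T
    (fun b hb => (hS'n b (Finset.mem_filter.1 hb).1).1) (fun b hb => (Finset.mem_filter.1 hb).2)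
  have hprod : ∀ b, (fib b).card ≤ ((fib b).image (fun p => p.1 % K)).card *
      ((fib b).image (fun p => p.2 % K)).card := by
    intro b
    rw [← Finset.card_product]
    refine Finset.card_le_card_of_injOn (fun p => (p.1 % K, p.2 % K)) ?_ ?_
    · intro p hp
      exact Finset.mem_product.2 ⟨Finset.mem_image_of_mem _ hp, Finset.mem_image_of_mem _ hp⟩
    · intro p hp q hq h
      obtain ⟨-, hp1, hp2⟩ := Finset.mem_filter.1 hp
      obtain ⟨-, hq1, hq2⟩ := Finset.mem_filter.1 hq
      simp only [Prod.mk.injEq] at h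
      apply Prod.ext
      · rw [← Nat.div_add_mod p.1 K, ← Nat.div_add_mod q.1 K, hp1, hq1, h.1]
      · rw [← Nat.div_add_mod p.2 K, ← Nat.div_add_mod q.2 K, hp2, hq2, h.2]
  have hKb : ∀ (b) (g : ℕ × ℕ → ℕ), ((fib b).image (fun p => g p % K)).card ≤ K := by
    intro b g
    calc _ ≤ (Finset.range K).card := Finset.card_le_card (by
          intro x hx
          obtain ⟨p, -, rfl⟩ := Finset.mem_image.1 hx
          exact Finset.mem_range.2 (Nat.mod_lt _ hK))
      _ = K := Finset.card_range K
  have hfb : ∀ b ∈ S', (fib b).card ≤ (k - 1) ^ 2 + (if b ∈ W then K ^ 2 else 0)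
      + (if b ∈ T then K ^ 2 else 0) := by
    intro b hb
    have hfull : (fib b).card ≤ K ^ 2 := by
      refine (hprod b).trans ?_
      rw [sq]
      exact Nat.mul_le_mul (hKb b _) (hKb b _)
    by_cases h1 : b ∈ W
    · simp only [h1, if_true]; omega
    by_cases h2 : b ∈ T
    · simp only [h2, if_true]; omega
    simp only [h1, h2, if_false, add_zero]
    refine (hprod b).trans ?_
    rw [sq]
    have h1' : ¬ k ≤ ((fib b).image (fun p => p.2 % K)).card := fun h =>
      h1 (Finset.mem_filter.2 ⟨hb, h⟩)
    have h2' : ¬ k ≤ ((fib b).image (fun p => p.1 % K)).card := fun h =>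
      h2 (Finset.mem_filter.2 ⟨hb, h⟩)
    exact Nat.mul_le_mul (by omega) (by omega)
  rw [hsum]
  refine (Finset.sum_le_sum hfb).trans ?_
  rw [Finset.sum_add_distrib, Finset.sum_add_distrib, Finset.sum_const, ← Finset.sum_filter,
    ← Finset.sum_filter, Finset.sum_const, Finset.sum_const]
  have e1 : (S'.filter fun b => b ∈ W).card ≤ n * 2 ^ K * k :=
    (Finset.card_le_card (fun b hb => (Finset.mem_filter.1 hb).2)).trans hW
  have e2 : (S'.filter fun b => b ∈ T).card ≤ n * 2 ^ K * k :=
    (Finset.card_le_card (fun b hb => (Finset.mem_filter.1 hb).2)).trans hT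
  simp only [smul_eq_mul]
  have e3 := Nat.mul_le_mul_right (K ^ 2) e1
  have e4 := Nat.mul_le_mul_right (K ^ 2) e2
  have e5 := Nat.mul_le_mul_right ((k - 1) ^ 2) hS'card
  nlinarith

lemma mt {k : ℕ} (hk : 0 < k) (π : Equiv.Perm (Fin k)) :
    ∃ C : ℕ, ∀ j : ℕ, exP ((k ^ 2) ^ j) π ≤ C * (k ^ 2) ^ j := by
  obtain ⟨k, rfl⟩ : ∃ k', k = k' + 1 := ⟨k - 1, by omega⟩
  set K := (k + 1) ^ 2 with hKd
  have hK : 0 < K := by positivity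
  set B := 2 * (2 ^ K * (k + 1)) * K ^ 2 with hB
  refine ⟨B + 1, fun j => exP_le _ _ _ ?_⟩
  induction j with
  | zero =>
    intro S hS _
    have : S ⊆ {(0, 0)} := by
      intro p hp
      have := hS p hp
      simp only [pow_zero, Nat.lt_one_iff] at this
      simp [Prod.ext_iff, this]
    have := Finset.card_le_card this
    simp at this ⊢
    omega
  | succ j ih =>
    intro S hS hc
    have := mt_step hk K (K ^ j) _ hK π ih S (by
      intro p hp
      have := hS p hp
      rwa [pow_succ'] at this) hc
    refine this.trans ?_
    have e : (k + 1 - 1) ^ 2 + 1 ≤ K := by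
      rw [hKd]; simp only [Nat.add_sub_cancel]; nlinarith
    have e2 : 2 * (K ^ j * 2 ^ K * (k + 1)) * K ^ 2 = B * K ^ j := by rw [hB]; ring
    rw [e2, pow_succ' K j]
    have e3 := Nat.mul_le_mul_right ((B + 1) * K ^ j) e
    have e4 : 0 ≤ K ^ j := Nat.zero_le _
    generalize (k + 1 - 1) ^ 2 = q at *
    nlinarith

lemma cobdd {k : ℕ} (hk : 2 < k) (π : Equiv.Perm (Fin k)) :
    IsCoboundedUnder (· ≥ ·) atTop (fun n : ℕ => (exP n π : ℝ) / (n : ℝ)) := by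
  obtain ⟨C, hC⟩ := mt (by omega) π
  refine IsCoboundedUnder.of_frequently_le (a := (C : ℝ)) ?_
  rw [frequently_atTop]
  intro a
  refine ⟨(k ^ 2) ^ a, (Nat.lt_pow_self (by nlinarith)).le, ?_⟩
  have hpos : (0 : ℝ) < (((k ^ 2) ^ a : ℕ) : ℝ) := by
    have : 0 < (k ^ 2) ^ a := by positivity
    exact_mod_cast this
  rw [div_le_iff₀ hpos]
  exact_mod_cast hC a

end StanleyWilf
namespace StanleyWilf

lemma grid_minor (l N : ℕ) (hl : 0 < l) (hN : 0 < N) (A : Fin N → Fin N → Bool) (r c : ℕ → ℕ)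
    (hr : ∀ i j, i < j → j < (l + 2) ^ 2 → r i < r j)
    (hc : ∀ i j, i < j → j < (l + 2) ^ 2 → c i < c j)
    (h : ∀ a b, a < l + 2 → b < l + 2 → r ((l + 2) * a + b) / N = c ((l + 2) * b + a) / N ∧
      A ⟨r ((l + 2) * a + b) % N, Nat.mod_lt _ hN⟩ ⟨c ((l + 2) * b + a) % N, Nat.mod_lt _ hN⟩ = true) :
    IntervalMinor (J l l) A := by
  set L := l + 2 with hL
  have hr' : ∀ i j, i ≤ j → j < L ^ 2 → r i ≤ r j := by
    intro i j hij hj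
    rcases hij.lt_or_eq with h1 | h1
    · exact (hr i j h1 hj).le
    · rw [h1]
  have hc' : ∀ i j, i ≤ j → j < L ^ 2 → c i ≤ c j := by
    intro i j hij hj
    rcases hij.lt_or_eq with h1 | h1
    · exact (hc i j h1 hj).le
    · rw [h1]
  have hend : L * (l + 1) < L ^ 2 := by rw [sq]; exact Nat.mul_lt_mul_of_pos_left (by omega) (by omega)
  have hend2 : l + 1 ≤ L * (l + 1) := Nat.le_mul_of_pos_left _ (by omega)
  have h1 := (h (l + 1) 0 (by omega) (by omega)).1
  have h2 := (h 0 (l + 1) (by omega) (by omega)).1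
  simp only [Nat.add_zero, Nat.mul_zero, Nat.zero_add] at h1 h2
  have h3 : r (l + 1) / N ≤ r (L * (l + 1)) / N := Nat.div_le_div_right (hr' _ _ hend2 hend)
  have h4 : c (l + 1) / N ≤ c (L * (l + 1)) / N := Nat.div_le_div_right (hc' _ _ hend2 hend)
  set q := r (l + 1) / N with hq
  have hrq : ∀ i, l + 1 ≤ i → i ≤ L * (l + 1) → N * q + r i % N = r i := by
    intro i hi1 hi2
    have e1 : r (l + 1) / N ≤ r i / N := Nat.div_le_div_right (hr' _ _ hi1 (by omega))
    have e2 : r i / N ≤ r (L * (l + 1)) / N := Nat.div_le_div_right (hr' _ _ hi2 hend)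
    have e3 : q = r i / N := by omega
    rw [e3, Nat.div_add_mod]
  have hcq : ∀ i, l + 1 ≤ i → i ≤ L * (l + 1) → N * q + c i % N = c i := by
    intro i hi1 hi2
    have e1 : c (l + 1) / N ≤ c i / N := Nat.div_le_div_right (hc' _ _ hi1 (by omega))
    have e2 : c i / N ≤ c (L * (l + 1)) / N := Nat.div_le_div_right (hc' _ _ hi2 hend)
    have e3 : q = c i / N := by omega
    rw [e3, Nat.div_add_mod]
  have hin : ∀ (a : Fin l) (b : ℕ), b < L → l + 1 ≤ L * (a + 1) + b ∧ L * (a + 1) + b ≤ L * (l + 1) := by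
    intro a b hb
    have ha := a.2
    have e : L * (a + 2) ≤ L * (l + 1) := Nat.mul_le_mul_left _ (by omega)
    constructor <;> nlinarith [Nat.zero_le (L * a)]
  have hsep : ∀ a b : Fin l, a < b → L * ((a : ℕ) + 1) + (l + 1) < L * (b + 1) + 0 := by
    intro a b hab
    have hab' : (a : ℕ) < b := hab
    have e : L * ((a : ℕ) + 2) ≤ L * (b + 1) := Nat.mul_le_mul_left _ (by omega)
    nlinarith
  refine ⟨fun a => ⟨r (L * (a + 1) + 0) % N, Nat.mod_lt _ hN⟩,
    fun a => ⟨r (L * (a + 1) + (l + 1)) % N, Nat.mod_lt _ hN⟩,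
    fun a => ⟨c (L * (a + 1) + 0) % N, Nat.mod_lt _ hN⟩,
    fun a => ⟨c (L * (a + 1) + (l + 1)) % N, Nat.mod_lt _ hN⟩, ?_, ?_, ?_, ?_, ?_⟩
  · intro a
    have i1 := hin a 0 (by omega)
    have i2 := hin a (l + 1) (by omega)
    have e1 := hrq _ i1.1 i1.2
    have e2 := hrq _ i2.1 i2.2
    have e3 := hr' (L * (a + 1) + 0) (L * (a + 1) + (l + 1)) (by omega) (by omega)
    rw [Fin.mk_le_mk]; omega
  · intro a b hab
    have i1 := hin b 0 (by omega)
    have i2 := hin a (l + 1) (by omega)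
    have e1 := hrq _ i1.1 i1.2
    have e2 := hrq _ i2.1 i2.2
    have e3 := hr _ _ (hsep a b hab) (by omega)
    rw [Fin.mk_lt_mk]; omega
  · intro a
    have i1 := hin a 0 (by omega)
    have i2 := hin a (l + 1) (by omega)
    have e1 := hcq _ i1.1 i1.2
    have e2 := hcq _ i2.1 i2.2
    have e3 := hc' (L * (a + 1) + 0) (L * (a + 1) + (l + 1)) (by omega) (by omega)
    rw [Fin.mk_le_mk]; omega
  · intro a b hab
    have i1 := hin b 0 (by omega)
    have i2 := hin a (l + 1) (by omega)
    have e1 := hcq _ i1.1 i1.2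
    have e2 := hcq _ i2.1 i2.2
    have e3 := hc _ _ (hsep a b hab) (by omega)
    rw [Fin.mk_lt_mk]; omega
  · intro a b _
    refine ⟨_, _, ?_, ?_, ?_, ?_, (h (a + 1) (b + 1) (by omega) (by omega)).2⟩
    · have i1 := hin a 0 (by omega)
      have i2 := hin a (b + 1) (by omega)
      have e1 := hrq _ i1.1 i1.2
      have e2 := hrq _ i2.1 i2.2
      have e3 := hr' (L * (a + 1) + 0) (L * (a + 1) + (b + 1)) (by omega) (by omega)
      rw [Fin.mk_le_mk]; omega
    · have i1 := hin a (b + 1) (by omega)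
      have i2 := hin a (l + 1) (by omega)
      have e1 := hrq _ i1.1 i1.2
      have e2 := hrq _ i2.1 i2.2
      have e3 := hr' (L * (a + 1) + (b + 1)) (L * (a + 1) + (l + 1)) (by omega) (by omega)
      rw [Fin.mk_le_mk]; omega
    · have i1 := hin b 0 (by omega)
      have i2 := hin b (a + 1) (by omega)
      have e1 := hcq _ i1.1 i1.2
      have e2 := hcq _ i2.1 i2.2
      have e3 := hc' (L * (b + 1) + 0) (L * (b + 1) + (a + 1)) (by omega) (by omega)
      rw [Fin.mk_le_mk]; omega
    · have i1 := hin b (a + 1) (by omega)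
      have i2 := hin b (l + 1) (by omega)
      have e1 := hcq _ i1.1 i1.2
      have e2 := hcq _ i2.1 i2.2
      have e3 := hc' (L * (b + 1) + (a + 1)) (L * (b + 1) + (l + 1)) (by omega) (by omega)
      rw [Fin.mk_le_mk]; omega

lemma exists_grid_perm (L k : ℕ) (hL : 0 < L) (hk : L ^ 2 ≤ k) :
    ∃ π : Equiv.Perm (Fin k), ∀ a b, a < L → b < L → ∀ (h : L * a + b < k) ,
      (π ⟨L * a + b, h⟩ : ℕ) = L * b + a := by
  let f : ℕ → ℕ := fun i => if i < L ^ 2 then L * (i % L) + i / L else i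
  have hlt : ∀ a b, a < L → b < L → L * a + b < L ^ 2 := by
    intro a b ha hb
    have : L * (a + 1) ≤ L * L := Nat.mul_le_mul_left _ ha
    nlinarith
  have hf : ∀ a b, a < L → b < L → f (L * a + b) = L * b + a := by
    intro a b ha hb
    simp only [f, hlt a b ha hb, if_true]
    rw [Nat.mul_add_mod, Nat.mod_eq_of_lt hb, Nat.mul_add_div hL, Nat.div_eq_of_lt hb, Nat.add_zero]
  have hdec : ∀ i, i < L ^ 2 → ∃ a b, a < L ∧ b < L ∧ i = L * a + b := by
    intro i hi
    exact ⟨i / L, i % L, Nat.div_lt_of_lt_mul (by rwa [← sq]), Nat.mod_lt _ hL,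
      (Nat.div_add_mod i L).symm⟩
  have hfk : ∀ i, i < k → f i < k := by
    intro i hi
    by_cases h : i < L ^ 2
    · obtain ⟨a, b, ha, hb, rfl⟩ := hdec i h
      rw [hf a b ha hb]
      exact (hlt b a hb ha).trans_le hk
    · simp only [f, h, if_false]; exact hi
  have hff : ∀ i, f (f i) = i := by
    intro i
    by_cases h : i < L ^ 2
    · obtain ⟨a, b, ha, hb, rfl⟩ := hdec i h
      rw [hf a b ha hb, hf b a hb ha]
    · simp only [f, h, if_false]
  refine ⟨Function.Involutive.toPerm (fun i : Fin k => ⟨f i, hfk i i.2⟩) ?_, ?_⟩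
  · intro i
    exact Fin.ext (hff i)
  · intro a b ha hb h
    exact hf a b ha hb

lemma exists_perm (l k : ℕ) (hl : 0 < l) (hk : (l + 2) ^ 2 ≤ k) :
    ∃ π : Equiv.Perm (Fin k), ∀ N, 0 < N → ∀ A : Fin N → Fin N → Bool,
      ¬ IntervalMinor (J l l) A → ∀ n, (n / N) * mass A ≤ exP n π := by
  classical
  obtain ⟨π, hπ⟩ := exists_grid_perm (l + 2) k (by omega) hk
  refine ⟨π, fun N hN A hA n => ?_⟩
  let U := (Finset.univ.filter fun p : Fin N × Fin N => A p.1 p.2 = true)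
  let g : ℕ × (Fin N × Fin N) → ℕ × ℕ := fun x => (N * x.1 + x.2.1, N * x.1 + x.2.2)
  have hdm : ∀ t (u : Fin N), (N * t + u) / N = t ∧ (N * t + u) % N = u := by
    intro t u
    rw [Nat.mul_add_mod, Nat.mod_eq_of_lt u.2, Nat.mul_add_div hN, Nat.div_eq_of_lt u.2]
    simp
  have hg : Function.Injective g := by
    rintro ⟨t, u, v⟩ ⟨t', u', v'⟩ h
    simp only [g, Prod.mk.injEq] at h
    have a1 := hdm t u
    have a2 := hdm t' u'
    have a3 := hdm t v
    have a4 := hdm t' v'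
    rw [h.1] at a1
    rw [h.2] at a3
    have e1 : t = t' := a1.1.symm.trans a2.1
    have e2 : u = u' := Fin.ext (a1.2.symm.trans a2.2)
    have e3 : v = v' := Fin.ext (a3.2.symm.trans a4.2)
    rw [e1, e2, e3]
  have hcard : (n / N) * mass A = ((Finset.range (n / N) ×ˢ U).image g).card := by
    rw [Finset.card_image_of_injective _ hg, Finset.card_product, Finset.card_range]; rfl
  rw [hcard]
  have hmem : ∀ p ∈ (Finset.range (n / N) ×ˢ U).image g, p.1 / N = p.2 / N ∧
      A ⟨p.1 % N, Nat.mod_lt _ hN⟩ ⟨p.2 % N, Nat.mod_lt _ hN⟩ = true := by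
    intro p hp
    obtain ⟨⟨t, u, v⟩, hx, rfl⟩ := Finset.mem_image.1 hp
    have hA' : A u v = true := by
      simpa [U] using (Finset.mem_product.1 hx).2
    simp only [g]
    have a1 := hdm t u
    have a3 := hdm t v
    refine ⟨a1.1.trans a3.1.symm, ?_⟩
    convert hA' using 2
    · exact Fin.ext a1.2
    · exact Fin.ext a3.2
  refine le_exP n π _ ?_ ?_
  · intro p hp
    obtain ⟨⟨t, u, v⟩, hx, rfl⟩ := Finset.mem_image.1 hp
    have ht : t < n / N := by simpa using (Finset.mem_product.1 hx).1
    have h1 : N * (t + 1) ≤ N * (n / N) := Nat.mul_le_mul_left _ ht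
    have h2 := Nat.mul_div_le n N
    have hu := u.2
    have hv := v.2
    simp only [g]
    constructor <;> nlinarith
  · rintro ⟨r, c, hr, hc, h⟩
    apply hA
    refine grid_minor l N hl hN A (fun i => if hi : i < k then r ⟨i, hi⟩ else 0)
      (fun i => if hi : i < k then c ⟨i, hi⟩ else 0) ?_ ?_ ?_
    · intro i j hij hj
      have hj' : j < k := by omega
      have hi' : i < k := by omega
      simp only [hi', hj', dif_pos]
      exact hr hij
    · intro i j hij hj
      have hj' : j < k := by omega
      have hi' : i < k := by omega
      simp only [hi', hj', dif_pos]
      exact hc hij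
    · intro a b ha hb
      have hlt : ∀ a b, a < l + 2 → b < l + 2 → (l + 2) * a + b < k := by
        intro a b ha hb
        have : (l + 2) * (a + 1) ≤ (l + 2) * (l + 2) := Nat.mul_le_mul_left _ ha
        nlinarith
      have e1 := hlt a b ha hb
      have e2 := hlt b a hb ha
      have e3 : π ⟨(l + 2) * a + b, e1⟩ = ⟨(l + 2) * b + a, e2⟩ := Fin.ext (hπ a b ha hb e1)
      have := hmem _ (h ⟨(l + 2) * a + b, e1⟩)
      rw [e3] at this
      simp only [e1, e2, dif_pos]
      exact this

end StanleyWilf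
namespace StanleyWilf

lemma count_avoid {T ι : Type*} [Fintype T] [DecidableEq T] [Fintype ι] (M : ℕ)
    (g : ι → T) (hg : Function.Injective g) :
    (((Finset.univ.filter fun ω : T → Fin (M + 1) => ∀ x, ω (g x) ≠ 0).card : ℕ) : ℝ) =
      (Fintype.card (T → Fin (M + 1)) : ℝ) * (1 - 1 / ((M : ℝ) + 1)) ^ (Fintype.card ι) := by
  classical
  have h1 : (Finset.univ.filter fun ω : T → Fin (M + 1) => ∀ x, ω (g x) ≠ 0) =
      Fintype.piFinset (fun t => if t ∈ Finset.univ.image g then Finset.univ.erase (0 : Fin (M + 1))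
        else Finset.univ) := by
    ext ω
    simp only [Finset.mem_filter, Finset.mem_univ, true_and, Fintype.mem_piFinset]
    constructor
    · intro h t
      split_ifs with ht
      · obtain ⟨x, -, rfl⟩ := Finset.mem_image.1 ht
        simpa using h x
      · simp
    · intro h x
      have := h (g x)
      simpa using this
  rw [h1, Fintype.card_piFinset]
  have h2 : ∀ t : T, (((if t ∈ Finset.univ.image g then Finset.univ.erase (0 : Fin (M + 1))
        else Finset.univ).card : ℕ) : ℝ) =
        ((M : ℝ) + 1) * (if t ∈ Finset.univ.image g then (1 - 1 / ((M : ℝ) + 1)) else 1) := by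
    intro t
    have : (M : ℝ) + 1 ≠ 0 := by positivity
    split_ifs
    · rw [Finset.card_erase_of_mem (Finset.mem_univ _)]
      simp
      field_simp
      ring
    · simp
  push_cast
  rw [Finset.prod_congr rfl (fun t _ => h2 t), Finset.prod_mul_distrib, Finset.prod_const,
    Finset.prod_ite_mem, Finset.univ_inter, Finset.prod_const,
    Finset.card_image_of_injective _ hg]
  simp

/-- index of dyadic intervals -/
abbrev Dy (r : ℕ) := Fin (r + 1) × Fin (2 ^ r)

/-- dyadic interval of level `i` around `u` -/
def key {r : ℕ} (i : Fin (r + 1)) (u : Fin (2 ^ r)) : Dy r :=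
  (i, ⟨(u : ℕ) / 2 ^ (i : ℕ), (Nat.div_le_self _ _).trans_lt u.2⟩)

lemma dyadic {r l : ℕ} (x y : Fin l → Fin (2 ^ r)) (h1 : ∀ a, x a ≤ y a)
    (h2 : ∀ a b, a < b → y a < x b) :
    ∃ p : Fin l → Fin (r + 1), (∀ a u, x a ≤ u → u ≤ y a → key (p a) u = key (p a) (x a)) ∧
      Function.Injective (fun a => key (p a) (x a)) := by
  classical
  have ex : ∀ a, ∃ i : ℕ, (x a : ℕ) / 2 ^ i = (y a : ℕ) / 2 ^ i := fun a =>
    ⟨r, by rw [Nat.div_eq_of_lt (x a).2, Nat.div_eq_of_lt (y a).2]⟩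
  have hle : ∀ a, Nat.find (ex a) ≤ r := fun a => Nat.find_min' _ (by
    rw [Nat.div_eq_of_lt (x a).2, Nat.div_eq_of_lt (y a).2])
  have hsp := fun a => Nat.find_spec (ex a)
  have hmin := fun a i (hi : i < Nat.find (ex a)) => Nat.find_min (ex a) hi
  refine ⟨fun a => ⟨Nat.find (ex a), by have := hle a; omega⟩, ?_, ?_⟩
  · intro a u hu1 hu2
    simp only [key, Prod.mk.injEq, true_and, Fin.mk.injEq]
    have e1 : (x a : ℕ) / 2 ^ Nat.find (ex a) ≤ u / 2 ^ Nat.find (ex a) :=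
      Nat.div_le_div_right hu1
    have e2 : (u : ℕ) / 2 ^ Nat.find (ex a) ≤ y a / 2 ^ Nat.find (ex a) :=
      Nat.div_le_div_right hu2
    have := hsp a
    omega
  · have main : ∀ a b, a < b → Nat.find (ex a) = Nat.find (ex b) →
        (x a : ℕ) / 2 ^ Nat.find (ex a) = (x b : ℕ) / 2 ^ Nat.find (ex b) → False := by
      intro a b hab hi he
      have hs := hsp a
      have hsb := hsp b
      have hm := hmin a
      have hmb := hmin b
      have hxa : (x a : ℕ) ≤ y a := h1 a
      have hxb : (x b : ℕ) ≤ y b := h1 b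
      have hyx : (y a : ℕ) < x b := h2 a b hab
      rw [← hi] at he hsb hmb
      generalize Nat.find (ex a) = i at *
      rcases i with _ | i
      · simp at he hs; omega
      · have m1 := hm i (by omega)
        have m2 := hmb i (by omega)
        rw [pow_succ, ← Nat.div_div_eq_div_mul, ← Nat.div_div_eq_div_mul] at he hs hsb
        have d1 : (x a : ℕ) / 2 ^ i ≤ y a / 2 ^ i := Nat.div_le_div_right hxa
        have d2 : (y a : ℕ) / 2 ^ i ≤ x b / 2 ^ i := Nat.div_le_div_right hyx.le
        have d3 : (x b : ℕ) / 2 ^ i ≤ y b / 2 ^ i := Nat.div_le_div_right hxb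
        omega
    intro a b hab
    simp only [key, Prod.mk.injEq, Fin.mk.injEq] at hab
    rcases lt_trichotomy a b with h | h | h
    · exact (main a b h hab.1 hab.2).elim
    · exact h
    · exact (main b a h hab.1.symm hab.2.symm).elim

/-- the random matrix -/
def mat {r M : ℕ} (ω : Dy r × Dy r → Fin (M + 1)) : Fin (2 ^ r) → Fin (2 ^ r) → Bool :=
  fun u v => decide (∀ x : Fin (r + 1) × Fin (r + 1), ω (key x.1 u, key x.2 v) ≠ 0)

lemma minor_grid {r M l : ℕ} (ω : Dy r × Dy r → Fin (M + 1)) (h : IntervalMinor (J l l) (mat ω)) :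
    ∃ p q : Fin l → Dy r, Function.Injective p ∧ Function.Injective q ∧
      ∀ x : Fin l × Fin l, ω (p x.1, q x.2) ≠ 0 := by
  obtain ⟨x, y, z, w, h1, h2, h3, h4, h5⟩ := h
  obtain ⟨p, hp1, hp2⟩ := dyadic x y h1 h2
  obtain ⟨q, hq1, hq2⟩ := dyadic z w h3 h4
  refine ⟨_, _, hp2, hq2, ?_⟩
  rintro ⟨a, b⟩
  obtain ⟨i, j, a1, a2, a3, a4, a5⟩ := h5 a b rfl
  simp only [mat, decide_eq_true_eq] at a5
  have := a5 (p a, q b)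
  simp only at this
  rw [hp1 a i a1 a2, hq1 b j a3 a4] at this
  exact this

lemma bad_count (r M l : ℕ) :
    (Nat.card {ω : Dy r × Dy r → Fin (M + 1) // IntervalMinor (J l l) (mat ω)} : ℝ) ≤
      (((r + 1) * 2 ^ r : ℕ) : ℝ) ^ (2 * l) *
      ((Fintype.card (Dy r × Dy r → Fin (M + 1)) : ℝ) * (1 - 1 / ((M : ℝ) + 1)) ^ (l * l)) := by
  classical
  have hsub : (Finset.univ.filter fun ω : Dy r × Dy r → Fin (M + 1) => IntervalMinor (J l l) (mat ω))
      ⊆ (Finset.univ.filter fun pq : (Fin l → Dy r) × (Fin l → Dy r) =>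
          Function.Injective pq.1 ∧ Function.Injective pq.2).biUnion
        (fun pq => Finset.univ.filter fun ω : Dy r × Dy r → Fin (M + 1) =>
          ∀ x : Fin l × Fin l, ω (pq.1 x.1, pq.2 x.2) ≠ 0) := by
    intro ω hω
    obtain ⟨p, q, hp, hq, h⟩ := minor_grid ω (Finset.mem_filter.1 hω).2
    refine Finset.mem_biUnion.2 ⟨(p, q), ?_, ?_⟩
    · simp [hp, hq]
    · simpa using h
  rw [Nat.card_eq_fintype_card, Fintype.card_subtype]
  have h1 := (Finset.card_le_card hsub).trans Finset.card_biUnion_le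
  have h2 : ((Finset.univ.filter fun ω : Dy r × Dy r → Fin (M + 1) =>
      IntervalMinor (J l l) (mat ω)).card : ℝ) ≤ _ := Nat.cast_le.2 h1
  refine h2.trans ?_
  push_cast
  refine (Finset.sum_le_card_nsmul _ _ ((Fintype.card (Dy r × Dy r → Fin (M + 1)) : ℝ) *
    (1 - 1 / ((M : ℝ) + 1)) ^ (l * l)) ?_).trans ?_
  · rintro ⟨p, q⟩ hpq
    simp only [Finset.mem_filter, Finset.mem_univ, true_and] at hpq
    have := count_avoid M (fun x : Fin l × Fin l => (p x.1, q x.2)) (by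
      intro x y hxy
      simp only [Prod.mk.injEq] at hxy
      exact Prod.ext (hpq.1 hxy.1) (hpq.2 hxy.2))
    simp only [Fintype.card_prod, Fintype.card_fin] at this ⊢
    exact this.le
  · rw [nsmul_eq_mul]
    refine mul_le_mul_of_nonneg_right ?_ ?_
    · have h3 := Finset.card_le_univ (Finset.univ.filter fun pq : (Fin l → Dy r) × (Fin l → Dy r) =>
          Function.Injective pq.1 ∧ Function.Injective pq.2)
      have h4 : Fintype.card ((Fin l → Dy r) × (Fin l → Dy r)) = ((r + 1) * 2 ^ r) ^ (2 * l) := by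
        simp only [Fintype.card_prod, Fintype.card_fun, Fintype.card_fin]
        rw [two_mul, pow_add]
      rw [h4] at h3
      exact_mod_cast h3
    · have : (0 : ℝ) ≤ 1 - 1 / ((M : ℝ) + 1) := by
        rw [sub_nonneg, div_le_one (by positivity)]
        linarith [(Nat.cast_nonneg M : (0 : ℝ) ≤ M)]
      positivity

lemma mass_count (r M : ℕ) :
    ∑ ω : Dy r × Dy r → Fin (M + 1), (mass (mat ω) : ℝ) =
      ((2 : ℝ) ^ r * 2 ^ r) * ((Fintype.card (Dy r × Dy r → Fin (M + 1)) : ℝ) *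
        (1 - 1 / ((M : ℝ) + 1)) ^ ((r + 1) * (r + 1))) := by
  classical
  have h1 : ∀ ω : Dy r × Dy r → Fin (M + 1), (mass (mat ω) : ℝ) =
      ∑ p : Fin (2 ^ r) × Fin (2 ^ r), if mat ω p.1 p.2 = true then (1 : ℝ) else 0 := by
    intro ω
    simp only [mass, Finset.sum_boole]
  simp_rw [h1]
  rw [Finset.sum_comm]
  have h2 : ∀ p : Fin (2 ^ r) × Fin (2 ^ r),
      (∑ ω : Dy r × Dy r → Fin (M + 1), if mat ω p.1 p.2 = true then (1 : ℝ) else 0) =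
      (Fintype.card (Dy r × Dy r → Fin (M + 1)) : ℝ) *
        (1 - 1 / ((M : ℝ) + 1)) ^ ((r + 1) * (r + 1)) := by
    intro p
    rw [Finset.sum_boole]
    have := count_avoid M (fun x : Fin (r + 1) × Fin (r + 1) => (key x.1 p.1, key x.2 p.2)) (by
      intro x y hxy
      simp only [key, Prod.mk.injEq] at hxy
      exact Prod.ext hxy.1.1 hxy.2.1)
    simp only [mat, decide_eq_true_eq]
    rw [this]
    simp only [Fintype.card_prod, Fintype.card_fin]
  rw [Finset.sum_congr rfl (fun p _ => h2 p), Finset.sum_const, nsmul_eq_mul]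
  simp

lemma exists_good (r M l : ℕ)
    (hb : (((r + 1) * 2 ^ r : ℕ) : ℝ) ^ (2 * l) * (1 - 1 / ((M : ℝ) + 1)) ^ (l * l) ≤
      (1 - 1 / ((M : ℝ) + 1)) ^ ((r + 1) * (r + 1)) / 2) (hM : 0 < M) :
    ∃ A : Fin (2 ^ r) → Fin (2 ^ r) → Bool, ¬ IntervalMinor (J l l) A ∧
      (2 : ℝ) ^ r * 2 ^ r * ((1 - 1 / ((M : ℝ) + 1)) ^ ((r + 1) * (r + 1)) / 2) ≤ mass A := by
  classical
  by_contra hcon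
  push Not at hcon
  set ρ := (1 - 1 / ((M : ℝ) + 1)) with hρ
  set X := ρ ^ ((r + 1) * (r + 1)) / 2 with hX
  have hρ0 : 0 < ρ := by
    rw [hρ, sub_pos, div_lt_one (by positivity)]
    have : (0 : ℝ) < M := by exact_mod_cast hM
    linarith
  have hX0 : 0 < X := by positivity
  set c := (Fintype.card (Dy r × Dy r → Fin (M + 1)) : ℝ) with hc
  have hc0 : 0 < c := by
    rw [hc]; exact_mod_cast Fintype.card_pos
  have hmc := mass_count r M
  have hbc := bad_count r M l
  rw [Nat.card_eq_fintype_card, Fintype.card_subtype] at hbc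
  have hmass : ∀ ω : Dy r × Dy r → Fin (M + 1), (mass (mat ω) : ℝ) ≤ 2 ^ r * 2 ^ r := by
    intro ω
    have : mass (mat ω) ≤ 2 ^ r * 2 ^ r := by
      refine (Finset.card_le_univ _).trans ?_
      simp
    exact_mod_cast this
  have hlt : ∑ ω : Dy r × Dy r → Fin (M + 1), (mass (mat ω) : ℝ) <
      ∑ ω : Dy r × Dy r → Fin (M + 1), ((2 : ℝ) ^ r * 2 ^ r * X +
        if IntervalMinor (J l l) (mat ω) then (2 : ℝ) ^ r * 2 ^ r else 0) := by
    refine Finset.sum_lt_sum_of_nonempty ⟨fun _ => 0, Finset.mem_univ _⟩ ?_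
    intro ω _
    split_ifs with h
    · have := hmass ω
      have : (0 : ℝ) < (2 : ℝ) ^ r * 2 ^ r * X := by positivity
      linarith [hmass ω]
    · have := hcon (mat ω) h
      linarith
  rw [Finset.sum_add_distrib, Finset.sum_const, ← Finset.sum_filter, Finset.sum_const,
    nsmul_eq_mul, nsmul_eq_mul, Finset.card_univ, hmc] at hlt
  have h3 : (((r + 1) * 2 ^ r : ℕ) : ℝ) ^ (2 * l) * (c * ρ ^ (l * l)) ≤ c * X := by
    have := mul_le_mul_of_nonneg_left hb hc0.le
    linarith
  have h4 := hbc.trans h3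
  have h5 := mul_le_mul_of_nonneg_right h4 (show (0 : ℝ) ≤ 2 ^ r * 2 ^ r by positivity)
  have h6 : ρ ^ ((r + 1) * (r + 1)) = 2 * X := by rw [hX]; ring
  rw [h6] at hlt
  linarith

lemma core (r : ℕ) :
    ∃ A : Fin (2 ^ r) → Fin (2 ^ r) → Bool,
      ¬ IntervalMinor (J (20 * (r + 1) ^ 2) (20 * (r + 1) ^ 2)) A ∧
      (2 : ℝ) ^ r * ((3 / 2 : ℝ) ^ (r + 1) / 4) ≤ mass A := by
  set s := r + 1 with hs
  set l := 20 * s ^ 2 with hl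
  set M := 4 * s - 1 with hM
  have hM1 : (M : ℝ) + 1 = 4 * s := by
    have : M + 1 = 4 * s := by omega
    exact_mod_cast this
  have hs1 : (1 : ℝ) ≤ s := by exact_mod_cast (by omega : 1 ≤ s)
  set ρ := (1 - 1 / ((M : ℝ) + 1)) with hρ
  have hρ0 : 0 < ρ := by
    rw [hρ, hM1, sub_pos, div_lt_one (by positivity)]
    linarith
  -- lower bound
  have hlow : (3 / 4 : ℝ) ≤ ρ ^ s := by
    have := one_add_mul_le_pow (a := -(1 / (4 * (s : ℝ)))) (by
      have : 1 / (4 * (s : ℝ)) ≤ 1 := by rw [div_le_one (by positivity)]; linarith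
      linarith) s
    have e : (1 : ℝ) + s * -(1 / (4 * (s : ℝ))) = 3 / 4 := by field_simp; norm_num
    rw [e] at this
    rw [hρ, hM1, sub_eq_add_neg]
    exact this
  have hup : ρ ^ (4 * s) ≤ 1 / 2 := by
    have h1 : ρ ≤ Real.exp (-(1 / (4 * s))) := by
      rw [hρ, hM1]; exact Real.one_sub_le_exp_neg _
    calc ρ ^ (4 * s) ≤ Real.exp (-(1 / (4 * s))) ^ (4 * s) := pow_le_pow_left₀ hρ0.le h1 _
      _ = Real.exp (-1) := by
        rw [← Real.exp_nat_mul]; congr 1; push_cast; field_simp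
      _ ≤ 1 / 2 := by
        have := Real.add_one_le_exp (1 : ℝ)
        rw [Real.exp_neg, one_div]
        exact inv_anti₀ (by norm_num) (by linarith)
  have hlow2 : (3 / 4 : ℝ) ^ s ≤ ρ ^ (s * s) := by
    rw [pow_mul]; exact pow_le_pow_left₀ (by norm_num) hlow _
  have hup2 : ρ ^ (l * l) ≤ (1 / 2) ^ (5 * s * l) := by
    have : l * l = 4 * s * (5 * s * l) := by rw [hl]; ring
    rw [this, pow_mul]; exact pow_le_pow_left₀ (by positivity) hup _
  have hD : ((s * 2 ^ r : ℕ) : ℝ) ^ (2 * l) ≤ 2 ^ (4 * s * l) := by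
    have h1 : s * 2 ^ r ≤ 2 ^ (2 * s) := by
      rw [two_mul, pow_add]
      exact Nat.mul_le_mul (Nat.lt_two_pow_self).le (Nat.pow_le_pow_right (by norm_num) (by omega))
    have h2 : (s * 2 ^ r) ^ (2 * l) ≤ 2 ^ (4 * s * l) := by
      have : 4 * s * l = 2 * s * (2 * l) := by ring
      rw [this, pow_mul 2 (2 * s)]
      exact Nat.pow_le_pow_left h1 _
    exact_mod_cast h2
  have hsl : s + 1 ≤ s * l := by
    rw [hl]; have : 1 ≤ s := by omega
    nlinarith [Nat.mul_le_mul this this, Nat.mul_le_mul this (Nat.mul_le_mul this this)]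
  obtain ⟨A, hA, hm⟩ := exists_good r M l (by
    calc _ ≤ (2 : ℝ) ^ (4 * s * l) * (1 / 2) ^ (5 * s * l) := by
          exact mul_le_mul hD hup2 (by positivity) (by positivity)
      _ = (1 / 2) ^ (s * l) := by
          have : 5 * s * l = 4 * s * l + s * l := by ring
          rw [this, pow_add, ← mul_assoc, ← mul_pow]; norm_num
      _ ≤ (1 / 2) ^ (s + 1) := pow_le_pow_of_le_one (by norm_num) (by norm_num) hsl
      _ = (1 / 2) ^ s / 2 := by rw [pow_succ]; ring
      _ ≤ (3 / 4) ^ s / 2 := by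
          have : (1 / 2 : ℝ) ^ s ≤ (3 / 4) ^ s := pow_le_pow_left₀ (by norm_num) (by norm_num) _
          linarith
      _ ≤ ρ ^ (s * s) / 2 := by linarith) (by omega)
  refine ⟨A, hA, le_trans ?_ hm⟩
  rw [mul_assoc]
  refine mul_le_mul_of_nonneg_left ?_ (by positivity)
  have e : (2 : ℝ) ^ r * ((3 / 4 : ℝ) ^ s / 2) = (3 / 2 : ℝ) ^ s / 4 := by
    have : (3 / 2 : ℝ) ^ s = 2 ^ s * (3 / 4) ^ s := by rw [← mul_pow]; norm_num
    rw [this, hs, pow_succ (2 : ℝ) r]; ring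
  rw [← e]
  refine mul_le_mul_of_nonneg_left ?_ (by positivity)
  linarith

lemma final (k : ℕ) (hk : 2 < k) : ∃ π : Equiv.Perm (Fin k),
      (2 : ℝ) ^ ((1 / 45 : ℝ) * (k : ℝ) ^ ((1 : ℝ) / 4)) ≤
        liminf (fun n : ℕ => (exP n π : ℝ) / (n : ℝ)) atTop := by
  set x := (k : ℝ) ^ ((1 : ℝ) / 4) with hx
  have hx0 : 0 ≤ x := by positivity
  have hx4 : x ^ 4 = k := by
    rw [hx, ← Real.rpow_natCast, ← Real.rpow_mul (by positivity)]; norm_num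
  set s := ⌊x / 5⌋₊ with hs
  have hs1 : (s : ℝ) ≤ x / 5 := Nat.floor_le (by positivity)
  have hs2 : x / 5 < s + 1 := Nat.lt_floor_add_one _
  by_cases h8 : s < 8
  · refine ⟨1, le_liminf_of_le (cobdd hk 1) ?_⟩
    filter_upwards [eventually_ge_atTop 2] with n hn
    have hn0 : (0 : ℝ) < n := by exact_mod_cast (by omega : 0 < n)
    rw [le_div_iff₀ hn0]
    have h1 : (2 : ℝ) * n ≤ exP n (1 : Equiv.Perm (Fin k)) := by
      exact_mod_cast trivial_bound hk 1 n hn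
    refine le_trans ?_ h1
    refine mul_le_mul_of_nonneg_right ?_ hn0.le
    have h7 : (s : ℝ) ≤ 7 := by exact_mod_cast (by omega : s ≤ 7)
    calc (2 : ℝ) ^ ((1 / 45 : ℝ) * x) ≤ 2 ^ (1 : ℝ) :=
          Real.rpow_le_rpow_of_exponent_le (by norm_num) (by linarith)
      _ = 2 := by norm_num
  · push Not at h8
    obtain ⟨r, hr⟩ : ∃ r, s = r + 1 := ⟨s - 1, by omega⟩
    have hkk : (20 * s ^ 2 + 2) ^ 2 ≤ k := by
      have h1 : (5 * (s : ℝ)) ^ 4 ≤ x ^ 4 := pow_le_pow_left₀ (by positivity) (by linarith) 4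
      rw [hx4] at h1
      have h2 : (5 * s) ^ 4 ≤ k := by exact_mod_cast h1
      refine le_trans ?_ h2
      have h3 : (5 * s) ^ 4 = (25 * s ^ 2) ^ 2 := by ring
      rw [h3]
      exact Nat.pow_le_pow_left (by nlinarith) 2
    obtain ⟨π, hπ⟩ := exists_perm (20 * s ^ 2) k (by positivity) hkk
    obtain ⟨A, hA, hm⟩ := core r
    rw [← hr] at hA hm
    have hN : 0 < 2 ^ r := by positivity
    refine ⟨π, le_liminf_of_le (cobdd hk π) ?_⟩
    filter_upwards [eventually_ge_atTop (2 * 2 ^ r)] with n hn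
    have hn0 : (0 : ℝ) < n := by exact_mod_cast (by omega : 0 < n)
    rw [le_div_iff₀ hn0]
    have h1 : ((n / 2 ^ r : ℕ) : ℝ) * mass A ≤ exP n π := by
      exact_mod_cast hπ _ hN A hA n
    have h2 : (n : ℝ) ≤ 2 * (2 ^ r * ((n / 2 ^ r : ℕ) : ℝ)) := by
      have a1 := Nat.div_add_mod n (2 ^ r)
      have a2 := Nat.mod_lt n hN
      have : n ≤ 2 * (2 ^ r * (n / 2 ^ r)) := by omega
      exact_mod_cast this
    refine le_trans ?_ h1
    have h3 : (2 : ℝ) ^ ((1 / 45 : ℝ) * x) ≤ (3 / 2) ^ s / 8 := by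
      have e1 : (2 : ℝ) ^ ((s : ℝ) / 2) ≤ (3 / 2) ^ s := by
        have : (2 : ℝ) ^ ((s : ℝ) / 2) = ((2 : ℝ) ^ ((1 : ℝ) / 2)) ^ s := by
          rw [← Real.rpow_natCast, ← Real.rpow_mul (by norm_num)]; congr 1; ring
        rw [this]
        refine pow_le_pow_left₀ (by positivity) ?_ s
        rw [← Real.sqrt_eq_rpow]
        exact Real.sqrt_le_iff.2 ⟨by norm_num, by norm_num⟩
      have h8' : (8 : ℝ) ≤ s := by exact_mod_cast h8
      calc (2 : ℝ) ^ ((1 / 45 : ℝ) * x) ≤ 2 ^ ((s : ℝ) / 2 - 3) :=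
            Real.rpow_le_rpow_of_exponent_le (by norm_num) (by linarith)
        _ = 2 ^ ((s : ℝ) / 2) / 8 := by rw [Real.rpow_sub (by norm_num)]; norm_num
        _ ≤ _ := by linarith
    calc (2 : ℝ) ^ ((1 / 45 : ℝ) * x) * n ≤ (3 / 2) ^ s / 8 * (2 * (2 ^ r * ((n / 2 ^ r : ℕ) : ℝ))) :=
          mul_le_mul h3 h2 hn0.le (by positivity)
      _ = ((n / 2 ^ r : ℕ) : ℝ) * (2 ^ r * ((3 / 2) ^ s / 4)) := by ring
      _ ≤ _ := mul_le_mul_of_nonneg_left hm (by positivity)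

end StanleyWilf

/-- There is an absolute constant `c > 0` such that for every
integer `k > 2` there exists a `k`-permutation `π` with
`liminf_{n→∞} ex(n,π)/n ≥ 2^{c·k^{1/4}}`. -/
theorem stmt8 :
    ∃ c : ℝ, 0 < c ∧ ∀ k : ℕ, 2 < k → ∃ π : Equiv.Perm (Fin k),
      (2 : ℝ) ^ (c * (k : ℝ) ^ ((1 : ℝ) / 4)) ≤
        liminf (fun n : ℕ => (exP n π : ℝ) / (n : ℝ)) atTop := by
  exact ⟨1 / 45, by norm_num, fun k hk => StanleyWilf.final k hk⟩
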